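/- Let q ≥ 2 and n ≥ 1 be integers, μ ∈ [1,n], and ω ∈ (0,(q-1)/q). Set k = ⌊μ⌋ and π = k(k+1)/μ - k. Then the maximum over nonnegative vectors π = (π_s)_{s∈[n]} with Σ_s π_s = 1 and Σ_s π_s/s ≥ 1/μ of the quantity [ min over nonnegative ϑ with Σ_s π_s·ϑ_s = ω of Σ_s π_s·R_0(ϑ_s,s) ] is attained at the vector whose entries are all zero except π_k = π and π_{k+1} = 1 - π (the entry π_{k+1} being absent when μ = k is an integer, in which case π = 1). -/

import Mathlib

open Set

noncomputable section

/-- `P_s(z) = -(q-1)·[ (1+(q-1)z)^{s-1} - (1-z)^{s-1} ]`. -/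
def Pp (q s : ℕ) (z : ℝ) : ℝ :=
  -(((q:ℝ) - 1)) * ((1 + ((q:ℝ) - 1) * z) ^ (s - 1) - (1 - z) ^ (s - 1))

/-- `Q_s(z) = (1+(q-1)z)^s + (q-1)(1-z)^s`. -/
def Qp (q s : ℕ) (z : ℝ) : ℝ :=
  (1 + ((q:ℝ) - 1) * z) ^ s + ((q:ℝ) - 1) * (1 - z) ^ s

/-- `ζ_s^{-1}(z) = z·P_s(z)/Q_s(z)` (note that `ζ_1^{-1} ≡ 0` since `P_1 ≡ 0`). -/
def zetaInv (q s : ℕ) (z : ℝ) : ℝ := z * Pp q s z / Qp q s z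

/-- `λ_q(ω,s) = inf_{z∈(0,1]} [ -ω·log_q z - 1/s + (1/s)·log_q Q_s(z) ]`. -/
def lambdaQ (q : ℕ) (ω : ℝ) (s : ℕ) : ℝ :=
  ⨅ z : Set.Ioc (0:ℝ) 1,
    (-ω * Real.logb q (z : ℝ) - 1 / s + (1 / s) * Real.logb q (Qp q s (z : ℝ)))

/-- `R_0(ω,s) = (s-1)/s - λ_q(ω,s)`. -/
def R0 (q : ℕ) (ω : ℝ) (s : ℕ) : ℝ := ((s:ℝ) - 1) / s - lambdaQ q ω s

/-- The inner minimum `min_ϑ Σ_{s∈[n]} π_s·R_0(ϑ_s,s)` over nonnegative vectors `ϑ`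
with `Σ_s π_s·ϑ_s = ω`. -/
def innerMin (q n : ℕ) (ω : ℝ) (π : ℕ → ℝ) : ℝ :=
  sInf {t : ℝ | ∃ ϑ : ℕ → ℝ, (∀ s ∈ Finset.Icc 1 n, 0 ≤ ϑ s) ∧
    (∑ s ∈ Finset.Icc 1 n, π s * ϑ s) = ω ∧
    t = ∑ s ∈ Finset.Icc 1 n, π s * R0 q (ϑ s) s}

/-- `R̄_0(ω,n,μ) = max_π min_ϑ Σ_{s∈[n]} π_s·R_0(ϑ_s,s)`. -/
def Rbar0 (q n : ℕ) (ω μ : ℝ) : ℝ :=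
  sSup {r : ℝ | ∃ π : ℕ → ℝ, (∀ s ∈ Finset.Icc 1 n, 0 ≤ π s) ∧
    (∑ s ∈ Finset.Icc 1 n, π s) = 1 ∧
    1 / μ ≤ (∑ s ∈ Finset.Icc 1 n, π s / (s : ℝ)) ∧
    r = innerMin q n ω π}

theorem one_le_natCast_sub_one {q : ℕ} (hq : 2 ≤ q) : (1 : ℝ) ≤ (q : ℝ) - 1 := by
  have : (2 : ℝ) ≤ q := by exact_mod_cast hq
  linarith

theorem one_le_Qp {q : ℕ} (hq : 2 ≤ q) (s : ℕ) {z : ℝ} (hz : z ∈ Set.Icc (0 : ℝ) 1) :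
    1 ≤ Qp q s z := by
  have h1 := one_le_natCast_sub_one hq
  have hA : 1 ≤ (1 + ((q : ℝ) - 1) * z) ^ s :=
    one_le_pow₀ (by nlinarith [hz.1])
  have hB : 0 ≤ ((q : ℝ) - 1) * (1 - z) ^ s :=
    mul_nonneg (by linarith) (pow_nonneg (by linarith [hz.2]) s)
  unfold Qp
  linarith

theorem Qp_pos {q : ℕ} (hq : 2 ≤ q) (s : ℕ) {z : ℝ} (hz : z ∈ Set.Icc (0 : ℝ) 1) :
    0 < Qp q s z :=
  lt_of_lt_of_le one_pos (one_le_Qp hq s hz)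

theorem logb_Qp_one {q : ℕ} (hq : 2 ≤ q) {s : ℕ} (hs : 1 ≤ s) :
    Real.logb q (Qp q s 1) = s := by
  have h2 : (2 : ℝ) ≤ q := by exact_mod_cast hq
  have : Qp q s 1 = (q : ℝ) ^ s := by
    simp [Qp, show s ≠ 0 by omega]
  rw [this, Real.logb_pow, Real.logb_self_eq_one (by linarith), mul_one]

theorem le_R0 {q : ℕ} (hq : 2 ≤ q) {s : ℕ} (hs : 1 ≤ s) {θ : ℝ} (hθ : 0 ≤ θ) {z : ℝ}
    (hz : z ∈ Set.Ioc (0 : ℝ) 1) :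
    1 + θ * Real.logb q z - (1 / s) * Real.logb q (Qp q s z) ≤ R0 q θ s := by
  have h2 : (2 : ℝ) ≤ q := by exact_mod_cast hq
  have hs' : (0 : ℝ) < s := by exact_mod_cast hs
  have hbdd : BddBelow (Set.range fun z : Set.Ioc (0 : ℝ) 1 =>
      (-θ * Real.logb q (z : ℝ) - 1 / s + (1 / s) * Real.logb q (Qp q s (z : ℝ)))) := by
    refine ⟨-1 / s, ?_⟩
    rintro _ ⟨w, rfl⟩
    have h3 : Real.logb q (w : ℝ) ≤ 0 :=
      Real.logb_nonpos (by linarith) w.2.1.le w.2.2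
    have h4 : 0 ≤ Real.logb q (Qp q s (w : ℝ)) :=
      Real.logb_nonneg (by linarith) (one_le_Qp hq s ⟨w.2.1.le, w.2.2⟩)
    have h5 : 0 ≤ (1 / (s : ℝ)) * Real.logb q (Qp q s (w : ℝ)) := by positivity
    have h6 : 0 ≤ -θ * Real.logb q (w : ℝ) := by nlinarith
    have h7 : -1 / (s : ℝ) = -(1 / s) := by ring
    linarith
  have h := ciInf_le hbdd ⟨z, hz⟩
  simp only at h
  unfold R0 lambdaQ
  have h8 : ((s : ℝ) - 1) / s = 1 - 1 / s := by field_simp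
  rw [h8]
  linarith

theorem R0_le {q : ℕ} {s : ℕ} (hs : 1 ≤ s) {θ c : ℝ}
    (h : ∀ z ∈ Set.Ioc (0 : ℝ) 1, θ * Real.logb q z - (1 / s) * Real.logb q (Qp q s z) ≤ c) :
    R0 q θ s ≤ 1 + c := by
  have hs' : (0 : ℝ) < s := by exact_mod_cast hs
  have : Nonempty (Set.Ioc (0 : ℝ) 1) := ⟨⟨1, by norm_num, le_refl 1⟩⟩
  have hle : -1 / s - c ≤ lambdaQ q θ s := by
    refine le_ciInf fun z => ?_
    have h7 : -1 / (s : ℝ) = -(1 / s) := by ring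
    linarith [h z z.2]
  unfold R0
  have h8 : ((s : ℝ) - 1) / s = 1 + -1 / s := by field_simp; ring
  rw [h8]
  linarith

theorem R0_nonneg {q : ℕ} (hq : 2 ≤ q) {s : ℕ} (hs : 1 ≤ s) {θ : ℝ} (hθ : 0 ≤ θ) :
    0 ≤ R0 q θ s := by
  have hs' : (s : ℝ) ≠ 0 := by positivity
  have h := le_R0 hq hs hθ (z := 1) ⟨one_pos, le_refl 1⟩
  rw [logb_Qp_one hq hs, Real.logb_one, one_div_mul_cancel hs'] at h
  linarith

theorem R0_one_le {q : ℕ} (hq : 2 ≤ q) {θ : ℝ} (hθ : 0 ≤ θ) : R0 q θ 1 ≤ 0 := by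
  have h2 : (2 : ℝ) ≤ q := by exact_mod_cast hq
  have h := R0_le (q := q) (s := 1) le_rfl (θ := θ) (c := -1) fun z hz => by
    have h3 : Real.logb q z ≤ 0 := Real.logb_nonpos (by linarith) hz.1.le hz.2
    have h4 : Qp q 1 z = q := by unfold Qp; ring
    rw [h4, Real.logb_self_eq_one (by linarith)]
    norm_num
    nlinarith
  linarith

/-- A polynomial with nonnegative coefficients is log-convex in the logarithm of its variable:
tangent line inequality. -/
theorem log_sum_mul_pow_tangent {t : Finset ℕ} {c : ℕ → ℝ} (hc : ∀ i ∈ t, 0 ≤ c i) {x y : ℝ}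
    (hx : 0 < x) (hy : 0 < y) (hpos : 0 < ∑ i ∈ t, c i * x ^ i) :
    (∑ i ∈ t, i * (c i * x ^ i)) / (∑ i ∈ t, c i * x ^ i) * (Real.log y - Real.log x) ≤
      Real.log (∑ i ∈ t, c i * y ^ i) - Real.log (∑ i ∈ t, c i * x ^ i) := by
  set S := ∑ i ∈ t, c i * x ^ i with hS
  set d := Real.log y - Real.log x with hd
  set m := (∑ i ∈ t, i * (c i * x ^ i)) / S * d with hm
  have hmS : m * S = (∑ i ∈ t, i * (c i * x ^ i)) * d := by
    rw [hm]; field_simp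
  have hterm : ∀ i : ℕ, y ^ i = x ^ i * Real.exp (i * d) := by
    intro i
    rw [hd, Real.exp_nat_mul, Real.exp_sub, Real.exp_log hy, Real.exp_log hx, ← mul_pow]
    congr 1
    field_simp
  have hle : Real.exp m * S ≤ ∑ i ∈ t, c i * y ^ i := by
    have h1 : ∑ i ∈ t, c i * x ^ i * (Real.exp m * (1 + (i * d - m))) = Real.exp m * S := by
      have : ∀ i ∈ t, c i * x ^ i * (Real.exp m * (1 + (i * d - m))) =
          Real.exp m * (1 - m) * (c i * x ^ i) + Real.exp m * d * (i * (c i * x ^ i)) := by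
        intro i _; ring
      rw [Finset.sum_congr rfl this, Finset.sum_add_distrib, ← Finset.mul_sum, ← Finset.mul_sum,
        ← hS]
      linear_combination -(Real.exp m) * hmS
    rw [← h1]
    refine Finset.sum_le_sum fun i hi => ?_
    rw [hterm i, ← mul_assoc (c i)]
    refine mul_le_mul_of_nonneg_left ?_ (mul_nonneg (hc i hi) (pow_nonneg hx.le i))
    have h2 : Real.exp (i * d) = Real.exp m * Real.exp (i * d - m) := by
      rw [← Real.exp_add]; congr 1; ring
    rw [h2]
    refine mul_le_mul_of_nonneg_left ?_ (Real.exp_pos m).le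
    linarith [Real.add_one_le_exp (i * d - m)]
  have h3 := Real.log_le_log (mul_pos (Real.exp_pos m) hpos) hle
  rw [Real.log_mul (Real.exp_pos m).ne' hpos.ne', Real.log_exp] at h3
  linarith

/-- The coefficients of `Q_s`. -/
def Qcoeff (q s i : ℕ) : ℝ :=
  s.choose i * (((q : ℝ) - 1) ^ i + ((q : ℝ) - 1) * (-1) ^ i)

theorem Qcoeff_nonneg {q : ℕ} (hq : 2 ≤ q) (s i : ℕ) : 0 ≤ Qcoeff q s i := by
  have h1 := one_le_natCast_sub_one hq
  refine mul_nonneg (Nat.cast_nonneg _) ?_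
  rcases i with _ | i
  · simp
  · have h2 : 1 ≤ ((q : ℝ) - 1) ^ i := one_le_pow₀ h1
    rcases neg_one_pow_eq_or ℝ (i + 1) with h | h <;> rw [h, pow_succ] <;> nlinarith

theorem Qp_eq_sum (q s : ℕ) (z : ℝ) :
    Qp q s z = ∑ i ∈ Finset.range (s + 1), Qcoeff q s i * z ^ i := by
  have hA : (1 + ((q : ℝ) - 1) * z) ^ s = (((q : ℝ) - 1) * z + 1) ^ s := by ring
  have hB : (1 - z) ^ s = (-1 * z + 1) ^ s := by ring
  rw [Qp, hA, hB, add_pow, add_pow, Finset.mul_sum, ← Finset.sum_add_distrib]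
  refine Finset.sum_congr rfl fun i _ => ?_
  rw [Qcoeff, mul_pow, mul_pow, one_pow]
  ring

theorem sum_mul_Qcoeff (q s : ℕ) (z : ℝ) :
    ∑ i ∈ Finset.range (s + 1), i * (Qcoeff q s i * z ^ i) = -(s * (z * Pp q s z)) := by
  have h1 : HasDerivAt (Qp q s)
      (∑ i ∈ Finset.range (s + 1), Qcoeff q s i * (i * z ^ (i - 1))) z := by
    have : Qp q s = fun z => ∑ i ∈ Finset.range (s + 1), Qcoeff q s i * z ^ i :=
      funext (Qp_eq_sum q s)
    rw [this]
    exact HasDerivAt.fun_sum fun i _ => (hasDerivAt_pow i z).const_mul _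
  have h2 : HasDerivAt (Qp q s) (-(s * Pp q s z)) z := by
    have hA : HasDerivAt (fun z : ℝ => 1 + ((q : ℝ) - 1) * z) ((q : ℝ) - 1) z := by
      simpa using ((hasDerivAt_id z).const_mul ((q : ℝ) - 1)).const_add 1
    have hB : HasDerivAt (fun z : ℝ => 1 - z) (-1) z := by
      simpa using (hasDerivAt_id z).const_sub 1
    have hAB := (hA.fun_pow s).fun_add ((hB.fun_pow s).const_mul ((q : ℝ) - 1))
    refine hAB.congr_deriv ?_
    unfold Pp
    ring
  have h3 := h1.unique h2
  have h4 : ∑ i ∈ Finset.range (s + 1), i * (Qcoeff q s i * z ^ i) =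
      z * ∑ i ∈ Finset.range (s + 1), Qcoeff q s i * (i * z ^ (i - 1)) := by
    rw [Finset.mul_sum]
    refine Finset.sum_congr rfl fun i _ => ?_
    rcases i with _ | i
    · simp
    · rw [Nat.add_sub_cancel, pow_succ]; ring
  rw [h4, h3]
  ring

theorem zetaInv_nonpos {q : ℕ} (hq : 2 ≤ q) (s : ℕ) {z : ℝ} (hz : z ∈ Set.Icc (0 : ℝ) 1) :
    zetaInv q s z ≤ 0 := by
  have h1 := one_le_natCast_sub_one hq
  have hle : (1 - z) ^ (s - 1) ≤ (1 + ((q : ℝ) - 1) * z) ^ (s - 1) :=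
    pow_le_pow_left₀ (by linarith [hz.2]) (by nlinarith [hz.1]) _
  have hP : Pp q s z ≤ 0 := by
    unfold Pp
    nlinarith
  exact div_nonpos_of_nonpos_of_nonneg (mul_nonpos_of_nonneg_of_nonpos hz.1 hP) (Qp_pos hq s hz).le

theorem zetaInv_one {q : ℕ} (hq : 2 ≤ q) {s : ℕ} (hs : 2 ≤ s) :
    -zetaInv q s 1 = ((q : ℝ) - 1) / q := by
  have h2 : (2 : ℝ) ≤ q := by exact_mod_cast hq
  obtain ⟨t, rfl⟩ : ∃ t, s = t + 2 := ⟨s - 2, by omega⟩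
  have hq0 : (q : ℝ) ≠ 0 := by linarith
  simp [zetaInv, Pp, Qp]
  field_simp
  ring

theorem continuousOn_zetaInv {q : ℕ} (hq : 2 ≤ q) (s : ℕ) :
    ContinuousOn (zetaInv q s) (Set.Icc 0 1) := by
  unfold zetaInv
  refine ContinuousOn.div ?_ ?_ fun z hz => (Qp_pos hq s hz).ne'
  · unfold Pp; fun_prop
  · unfold Qp; fun_prop

theorem R0_neg_zetaInv_le {q : ℕ} (hq : 2 ≤ q) {s : ℕ} (hs : 1 ≤ s) {z : ℝ}
    (hz : z ∈ Set.Ioc (0 : ℝ) 1) :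
    R0 q (-zetaInv q s z) s ≤
      1 + (-zetaInv q s z * Real.logb q z - (1 / s) * Real.logb q (Qp q s z)) := by
  have h2 : (2 : ℝ) ≤ q := by exact_mod_cast hq
  have hs' : (0 : ℝ) < s := by exact_mod_cast hs
  refine R0_le hs fun w hw => ?_
  have hQ := Qp_pos hq s (Set.Ioc_subset_Icc_self hz)
  have h := log_sum_mul_pow_tangent (t := Finset.range (s + 1)) (fun i _ => Qcoeff_nonneg hq s i)
    hz.1 hw.1 (by rwa [← Qp_eq_sum])
  rw [← Qp_eq_sum, ← Qp_eq_sum, sum_mul_Qcoeff] at h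
  have h3 : -(s * (z * Pp q s z)) / Qp q s z = s * -zetaInv q s z := by
    unfold zetaInv; ring
  rw [h3] at h
  have hlq : 0 < Real.log q := Real.log_pos (by linarith)
  have key : -zetaInv q s z * (Real.log w - Real.log z) ≤
      (1 / s) * (Real.log (Qp q s w) - Real.log (Qp q s z)) := by
    rw [one_div, ← div_eq_inv_mul, le_div_iff₀ hs']
    linarith
  have key2 := div_le_div_of_nonneg_right key hlq.le
  unfold Real.logb
  have e1 : -zetaInv q s z * (Real.log w - Real.log z) / Real.log q =
      -zetaInv q s z * (Real.log w / Real.log q) - -zetaInv q s z * (Real.log z / Real.log q) := by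
    ring
  have e2 : (1 / (s : ℝ)) * (Real.log (Qp q s w) - Real.log (Qp q s z)) / Real.log q =
      (1 / s) * (Real.log (Qp q s w) / Real.log q) -
        (1 / s) * (Real.log (Qp q s z) / Real.log q) := by
    ring
  rw [e1, e2] at key2
  linarith

/-- Strong duality for the inner minimum. -/
theorem exists_dual_optimum {q : ℕ} (hq : 2 ≤ q) {n : ℕ} (hn : 1 ≤ n) {ω : ℝ}
    (hω : ω ∈ Set.Ioo (0 : ℝ) (((q : ℝ) - 1) / q)) {π : ℕ → ℝ}
    (hπ : ∀ s ∈ Finset.Icc 1 n, 0 ≤ π s) (hsum : ∑ s ∈ Finset.Icc 1 n, π s = 1) :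
    ∃ z ∈ Set.Ioc (0 : ℝ) 1, ∃ ϑ : ℕ → ℝ, (∀ s ∈ Finset.Icc 1 n, 0 ≤ ϑ s) ∧
      (∑ s ∈ Finset.Icc 1 n, π s * ϑ s) = ω ∧
      ∑ s ∈ Finset.Icc 1 n, π s * R0 q (ϑ s) s ≤
        1 + ω * Real.logb q z -
          ∑ s ∈ Finset.Icc 1 n, π s * ((1 / s) * Real.logb q (Qp q s z)) := by
  set D : ℝ → ℝ := fun z => ∑ s ∈ Finset.Icc 1 n, π s * -zetaInv q s z with hD
  have hDcont : ContinuousOn D (Set.Icc 0 1) :=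
    continuousOn_finsetSum _ fun s _ => ((continuousOn_zetaInv hq s).neg.const_mul (π s))
  have hD0 : D 0 = 0 := by simp [hD, zetaInv]
  rcases le_or_gt ω (D 1) with hcase | hcase
  · obtain ⟨z, hz, hzω⟩ := intermediate_value_Icc zero_le_one hDcont
      (show ω ∈ Set.Icc (D 0) (D 1) from ⟨hD0.le.trans hω.1.le, hcase⟩)
    have hz0 : z ≠ 0 := by
      rintro rfl
      linarith [hω.1]
    have hz' : z ∈ Set.Ioc (0 : ℝ) 1 := ⟨lt_of_le_of_ne hz.1 hz0.symm, hz.2⟩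
    refine ⟨z, hz', fun s => -zetaInv q s z,
      fun s _ => neg_nonneg.mpr (zetaInv_nonpos hq s hz), hzω, ?_⟩
    calc ∑ s ∈ Finset.Icc 1 n, π s * R0 q (-zetaInv q s z) s
        ≤ ∑ s ∈ Finset.Icc 1 n, π s *
          (1 + (-zetaInv q s z * Real.logb q z - (1 / s) * Real.logb q (Qp q s z))) :=
          Finset.sum_le_sum fun s hs => mul_le_mul_of_nonneg_left
            (R0_neg_zetaInv_le hq (Finset.mem_Icc.mp hs).1 hz') (hπ s hs)
      _ = (∑ s ∈ Finset.Icc 1 n, π s) + D z * Real.logb q z -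
          ∑ s ∈ Finset.Icc 1 n, π s * ((1 / s) * Real.logb q (Qp q s z)) := by
          rw [hD, Finset.sum_mul, ← Finset.sum_add_distrib, ← Finset.sum_sub_distrib]
          exact Finset.sum_congr rfl fun s _ => by ring
      _ = _ := by rw [hsum, hzω]
  · have hIcc : Finset.Icc 1 n = insert 1 (Finset.Icc 2 n) := by
      ext s; simp only [Finset.mem_insert, Finset.mem_Icc]; omega
    have hnot : (1 : ℕ) ∉ Finset.Icc 2 n := by simp
    have hz1 : zetaInv q 1 1 = 0 := by simp [zetaInv, Pp]
    have hD1 : D 1 = (1 - π 1) * (((q : ℝ) - 1) / q) := by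
      rw [hIcc, Finset.sum_insert hnot] at hsum
      simp only [hD]
      rw [hIcc, Finset.sum_insert hnot, hz1,
        Finset.sum_congr rfl fun s hs => by rw [zetaInv_one hq (Finset.mem_Icc.mp hs).1],
        ← Finset.sum_mul]
      linear_combination (((q : ℝ) - 1) / q) * hsum
    have hπ1 : 0 < π 1 := by
      refine lt_of_le_of_ne (hπ 1 (by simp [hn])) fun h => ?_
      rw [← h] at hD1
      linarith [hω.2]
    have hϑ0 : ∀ s ∈ Finset.Icc 1 n,
        0 ≤ if s = 1 then (ω - D 1) / π 1 else -zetaInv q s 1 := by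
      intro s _
      split_ifs
      · exact div_nonneg (by linarith) hπ1.le
      · exact neg_nonneg.mpr (zetaInv_nonpos hq s ⟨zero_le_one, le_refl 1⟩)
    have hone : (1 : ℝ) ∈ Set.Ioc (0 : ℝ) 1 := ⟨one_pos, le_refl 1⟩
    have hlog : ∀ s ∈ Finset.Icc 1 n, π s * ((1 / s) * Real.logb q (Qp q s 1)) = π s := by
      intro s hs
      have hs1 := (Finset.mem_Icc.mp hs).1
      have hs' : (s : ℝ) ≠ 0 := by positivity
      rw [logb_Qp_one hq hs1, one_div_mul_cancel hs', mul_one]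
    refine ⟨1, hone, fun s => if s = 1 then (ω - D 1) / π 1 else -zetaInv q s 1, hϑ0, ?_, ?_⟩
    · have hrest : ∑ s ∈ Finset.Icc 2 n,
          π s * (if s = 1 then (ω - D 1) / π 1 else -zetaInv q s 1) = D 1 := by
        simp only [hD]
        rw [hIcc, Finset.sum_insert hnot, hz1, neg_zero, mul_zero, zero_add]
        refine Finset.sum_congr rfl fun s hs => ?_
        rw [if_neg (by have := (Finset.mem_Icc.mp hs).1; omega)]
      rw [hIcc, Finset.sum_insert hnot, hrest]
      simp only [if_true]
      field_simp
      ring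
    · rw [Finset.sum_congr rfl hlog, hsum, Real.logb_one]
      simp only [mul_zero, add_zero, sub_self]
      refine Finset.sum_nonpos fun s hs => mul_nonpos_of_nonneg_of_nonpos (hπ s hs) ?_
      have hs1 := (Finset.mem_Icc.mp hs).1
      have h0 := hϑ0 s hs
      split_ifs with h
      · rw [if_pos h] at h0
        rw [h]
        exact R0_one_le hq h0
      · have hs' : (s : ℝ) ≠ 0 := by positivity
        have hR := R0_neg_zetaInv_le hq hs1 hone
        rw [logb_Qp_one hq hs1, Real.logb_one, one_div_mul_cancel hs'] at hR
        linarith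

theorem Qp_logConvex {q : ℕ} (hq : 2 ≤ q) (s : ℕ) {z : ℝ} (hz : z ∈ Set.Icc (0 : ℝ) 1) :
    Qp q (s + 1) z * Qp q (s + 1) z ≤ Qp q s z * Qp q (s + 2) z := by
  have h1 := one_le_natCast_sub_one hq
  have hB : 0 ≤ 1 - z := by linarith [hz.2]
  have hA : 0 ≤ 1 + ((q : ℝ) - 1) * z := by nlinarith [hz.1]
  unfold Qp
  set A := 1 + ((q : ℝ) - 1) * z
  set B := 1 - z
  have : 0 ≤ ((q : ℝ) - 1) * (A ^ s * B ^ s * (A - B) ^ 2) :=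
    mul_nonneg (by linarith) (by positivity)
  have e : (A ^ s + ((q : ℝ) - 1) * B ^ s) * (A ^ (s + 2) + ((q : ℝ) - 1) * B ^ (s + 2)) -
      (A ^ (s + 1) + ((q : ℝ) - 1) * B ^ (s + 1)) * (A ^ (s + 1) + ((q : ℝ) - 1) * B ^ (s + 1)) =
      ((q : ℝ) - 1) * (A ^ s * B ^ s * (A - B) ^ 2) := by ring
  linarith

theorem logb_Qp_midpoint {q : ℕ} (hq : 2 ≤ q) (s : ℕ) {z : ℝ} (hz : z ∈ Set.Icc (0 : ℝ) 1) :
    Real.logb q (Qp q (s + 1) z) + Real.logb q (Qp q (s + 1) z) ≤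
      Real.logb q (Qp q s z) + Real.logb q (Qp q (s + 2) z) := by
  have h2 : (2 : ℝ) ≤ q := by exact_mod_cast hq
  have p0 := Qp_pos hq s hz
  have p1 := Qp_pos hq (s + 1) hz
  have p2 := Qp_pos hq (s + 2) hz
  rw [← Real.logb_mul p1.ne' p1.ne', ← Real.logb_mul p0.ne' p2.ne']
  exact Real.logb_le_logb_of_le (by linarith) (mul_pos p1 p1) (Qp_logConvex hq s hz)

/-- A sequence with nondecreasing increments lies above the line through any two
consecutive terms. -/
theorem line_le_of_midpoint {h : ℕ → ℝ} (hconv : ∀ s, h (s + 1) + h (s + 1) ≤ h s + h (s + 2))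
    (k s : ℕ) : h k + ((s : ℝ) - k) * (h (k + 1) - h k) ≤ h s := by
  have hmono : Monotone fun s => h (s + 1) - h s :=
    monotone_nat_of_le_succ fun s => by linarith [hconv s]
  rcases le_total k s with hks | hks
  · induction s, hks using Nat.le_induction with
    | base => simp
    | succ s hs ih =>
      have := hmono hs
      push_cast
      simp only at this
      linarith
  · induction k, hks using Nat.le_induction with
    | base => simp
    | succ k hk ih =>
      have hsk : (s : ℝ) ≤ k := by exact_mod_cast hk
      have := hconv k
      push_cast
      nlinarith

theorem mul_logb_Qp_succ_le {q : ℕ} (hq : 2 ≤ q) (k : ℕ) {z : ℝ} (hz : z ∈ Set.Icc (0 : ℝ) 1) :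
    k * Real.logb q (Qp q (k + 1) z) ≤ (k + 1) * Real.logb q (Qp q k z) := by
  have h1 := one_le_natCast_sub_one hq
  have h2 : (2 : ℝ) ≤ q := by exact_mod_cast hq
  have hB : 0 ≤ 1 - z := by linarith [hz.2]
  have hA : 0 < 1 + ((q : ℝ) - 1) * z := by nlinarith [hz.1]
  have hBA : 1 - z ≤ 1 + ((q : ℝ) - 1) * z := by nlinarith [hz.1]
  have p0 := Qp_pos hq k hz
  have hBk : 0 ≤ ((q : ℝ) - 1) * (1 - z) ^ k := mul_nonneg (by linarith) (pow_nonneg hB k)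
  have hstep : Qp q (k + 1) z ≤ (1 + ((q : ℝ) - 1) * z) * Qp q k z := by
    unfold Qp
    rw [pow_succ, pow_succ]
    nlinarith
  have hpow : (1 + ((q : ℝ) - 1) * z) ^ k ≤ Qp q k z := by
    unfold Qp
    linarith
  have l1 := Real.logb_le_logb_of_le (b := (q : ℝ)) (by linarith) (Qp_pos hq (k + 1) hz) hstep
  have l2 := Real.logb_le_logb_of_le (b := (q : ℝ)) (by linarith) (pow_pos hA k) hpow
  rw [Real.logb_mul hA.ne' p0.ne'] at l1
  rw [Real.logb_pow] at l2
  have l3 := mul_le_mul_of_nonneg_left l1 (Nat.cast_nonneg (α := ℝ) k)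
  linarith

theorem innerMin_le_of_dual {q : ℕ} (hq : 2 ≤ q) {n : ℕ} (hn : 1 ≤ n) {ω : ℝ}
    (hω : ω ∈ Set.Ioo (0 : ℝ) (((q : ℝ) - 1) / q)) {π ρ : ℕ → ℝ}
    (hπ : ∀ s ∈ Finset.Icc 1 n, 0 ≤ π s) (hπsum : ∑ s ∈ Finset.Icc 1 n, π s = 1)
    (hρ : ∀ s ∈ Finset.Icc 1 n, 0 ≤ ρ s) (hρsum : ∑ s ∈ Finset.Icc 1 n, ρ s = 1)
    (hle : ∀ z ∈ Set.Ioc (0 : ℝ) 1,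
      ∑ s ∈ Finset.Icc 1 n, ρ s * ((1 / s) * Real.logb q (Qp q s z)) ≤
        ∑ s ∈ Finset.Icc 1 n, π s * ((1 / s) * Real.logb q (Qp q s z))) :
    innerMin q n ω π ≤ innerMin q n ω ρ := by
  obtain ⟨z, hz, ϑ, hϑ0, hϑω, hϑ⟩ := exists_dual_optimum hq hn hω hπ hπsum
  obtain ⟨_, _, ϑ', hϑ'0, hϑ'ω, _⟩ := exists_dual_optimum hq hn hω hρ hρsum
  have hupper : innerMin q n ω π ≤ ∑ s ∈ Finset.Icc 1 n, π s * R0 q (ϑ s) s := by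
    refine csInf_le ⟨0, ?_⟩ ⟨ϑ, hϑ0, hϑω, rfl⟩
    rintro _ ⟨η, hη0, _, rfl⟩
    exact Finset.sum_nonneg fun s hs =>
      mul_nonneg (hπ s hs) (R0_nonneg hq (Finset.mem_Icc.mp hs).1 (hη0 s hs))
  refine le_csInf ⟨_, ϑ', hϑ'0, hϑ'ω, rfl⟩ ?_
  rintro _ ⟨η, hη0, hηω, rfl⟩
  have hlower : 1 + ω * Real.logb q z -
      ∑ s ∈ Finset.Icc 1 n, ρ s * ((1 / s) * Real.logb q (Qp q s z)) ≤
      ∑ s ∈ Finset.Icc 1 n, ρ s * R0 q (η s) s := by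
    calc _ = ∑ s ∈ Finset.Icc 1 n,
          ρ s * (1 + η s * Real.logb q z - (1 / s) * Real.logb q (Qp q s z)) := by
          simp only [mul_sub, mul_add, mul_one, ← mul_assoc, Finset.sum_sub_distrib,
            Finset.sum_add_distrib, ← Finset.sum_mul, hρsum, hηω]
      _ ≤ _ := Finset.sum_le_sum fun s hs => mul_le_mul_of_nonneg_left
          (le_R0 hq (Finset.mem_Icc.mp hs).1 (hη0 s hs) hz) (hρ s hs)
  linarith [hle z hz]

/-- Lemma (outer maximization): the maximum defining `R̄_0(ω,n,μ)` is attained at the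
vector supported on `{k, k+1}` (`k = ⌊μ⌋`) with `π_k = k(k+1)/μ - k` and
`π_{k+1} = 1 - π_k`. -/
theorem outer_maximizer
    (q : ℕ) (hq : 2 ≤ q) (n : ℕ) (hn : 1 ≤ n)
    (μ : ℝ) (hμ : μ ∈ Set.Icc (1:ℝ) (n:ℝ))
    (ω : ℝ) (hω : ω ∈ Set.Ioo (0:ℝ) (((q:ℝ) - 1) / q))
    (k : ℕ) (hk : k = ⌊μ⌋₊)
    (πv : ℝ) (hπv : πv = (k : ℝ) * ((k : ℝ) + 1) / μ - (k : ℝ))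
    (πstar : ℕ → ℝ)
    (hπstar : πstar = fun s => if s = k then πv else if s = k + 1 then 1 - πv else 0) :
    -- `πstar` satisfies the constraints of the outer maximization
    (∀ s ∈ Finset.Icc 1 n, 0 ≤ πstar s) ∧
    (∑ s ∈ Finset.Icc 1 n, πstar s) = 1 ∧
    1 / μ ≤ (∑ s ∈ Finset.Icc 1 n, πstar s / (s : ℝ)) ∧
    -- and it attains the maximum
    innerMin q n ω πstar = Rbar0 q n ω μ := by
  obtain ⟨hμ1, hμn⟩ := hμ
  have hμ0 : 0 < μ := by linarith
  have hkμ : (k : ℝ) ≤ μ := hk ▸ Nat.floor_le hμ0.le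
  have hμk : μ < k + 1 := hk ▸ Nat.lt_floor_add_one μ
  have hk1 : 1 ≤ k := by rw [hk]; exact Nat.le_floor (by simpa using hμ1)
  have hkn : k ≤ n := by exact_mod_cast hkμ.trans hμn
  have hk0 : (0 : ℝ) < k := by exact_mod_cast hk1
  have hπμ : (πv + k) * μ = k * (k + 1) := by rw [hπv]; field_simp; ring
  have hπ0 : 0 ≤ πv := by
    have : 0 ≤ πv * μ := by nlinarith
    exact nonneg_of_mul_nonneg_left this hμ0
  have hπ1 : πv ≤ 1 := by
    have : 0 ≤ (1 - πv) * μ := by nlinarith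
    linarith [nonneg_of_mul_nonneg_left this hμ0]
  have hπn : k = n → πv = 1 := by
    intro h
    have hμk' : μ = k := le_antisymm (h ▸ hμn) hkμ
    rw [hμk'] at hπμ
    have := mul_right_cancel₀ hk0.ne' (hπμ.trans (mul_comm _ _))
    linarith
  have hsum : ∀ f : ℕ → ℝ, ∑ s ∈ Finset.Icc 1 n, πstar s * f s =
      πv * f k + (1 - πv) * f (k + 1) := by
    intro f
    have hsplit : ∀ s ∈ Finset.Icc 1 n, πstar s * f s =
        (if s = k then πv * f k else 0) + (if s = k + 1 then (1 - πv) * f (k + 1) else 0) := by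
      intro s _
      rw [hπstar]
      by_cases h1 : s = k
      · subst h1; simp
      · by_cases h2 : s = k + 1
        · subst h2; simp
        · simp [h1, h2]
    rw [Finset.sum_congr rfl hsplit, Finset.sum_add_distrib, Finset.sum_ite_eq',
      Finset.sum_ite_eq', if_pos (Finset.mem_Icc.mpr ⟨hk1, hkn⟩)]
    split_ifs with h
    · rfl
    · rw [hπn (by rw [Finset.mem_Icc] at h; omega)]
      ring
  have hnonneg : ∀ s ∈ Finset.Icc 1 n, 0 ≤ πstar s := by
    intro s _
    rw [hπstar]
    dsimp only
    split_ifs <;> linarith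
  have hone : ∑ s ∈ Finset.Icc 1 n, πstar s = 1 := by
    have := hsum fun _ => 1
    simp only [mul_one] at this
    linarith
  have hinv : ∑ s ∈ Finset.Icc 1 n, πstar s / (s : ℝ) = 1 / μ := by
    have := hsum fun s => (s : ℝ)⁻¹
    simp only [← div_eq_mul_inv] at this
    rw [this, hπv]
    push_cast
    field_simp
    ring
  refine ⟨hnonneg, hone, hinv.ge,
    Eq.symm (IsGreatest.csSup_eq ⟨⟨πstar, hnonneg, hone, hinv.ge, rfl⟩, ?_⟩)⟩
  rintro _ ⟨π, hπ, hπsum, hπinv, rfl⟩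
  refine innerMin_le_of_dual hq hn hω hπ hπsum hnonneg hone fun z hz => ?_
  have hz' := Set.Ioc_subset_Icc_self hz
  set h : ℕ → ℝ := fun s => Real.logb q (Qp q s z)
  have hline := line_le_of_midpoint (h := h) (fun s => logb_Qp_midpoint hq s hz') k
  have hb : (0 : ℝ) ≤ (k + 1) * h k - k * h (k + 1) := by
    linarith [mul_logb_Qp_succ_le hq k hz']
  calc ∑ s ∈ Finset.Icc 1 n, πstar s * ((1 / s) * h s)
      = (h (k + 1) - h k) + ((k + 1) * h k - k * h (k + 1)) * (1 / μ) := by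
        rw [hsum fun s => (1 / (s : ℝ)) * h s, hπv]
        push_cast
        field_simp
        ring
    _ ≤ (h (k + 1) - h k) + ((k + 1) * h k - k * h (k + 1)) *
          ∑ s ∈ Finset.Icc 1 n, π s / (s : ℝ) := by
        linarith [mul_le_mul_of_nonneg_left hπinv hb]
    _ = ∑ s ∈ Finset.Icc 1 n,
          (π s * (h (k + 1) - h k) + ((k + 1) * h k - k * h (k + 1)) * (π s / (s : ℝ))) := by
        rw [Finset.sum_add_distrib, ← Finset.sum_mul, ← Finset.mul_sum, hπsum, one_mul]
    _ ≤ ∑ s ∈ Finset.Icc 1 n, π s * ((1 / s) * h s) := by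
        refine Finset.sum_le_sum fun s hs => ?_
        have hs0 : (0 : ℝ) < s := by exact_mod_cast (Finset.mem_Icc.mp hs).1
        have e : π s * (h (k + 1) - h k) + ((k + 1) * h k - k * h (k + 1)) * (π s / (s : ℝ)) =
            π s * ((1 / s) * (h k + ((s : ℝ) - k) * (h (k + 1) - h k))) := by
          field_simp
          ring
        rw [e]
        exact mul_le_mul_of_nonneg_left
          (mul_le_mul_of_nonneg_left (hline s) (by positivity)) (hπ s hs)
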